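/- arXiv:0906.4438 — 3 statements merged into one kernel-verified Lean document; each statement's English description precedes it below -/
import Mathlib

section
/- Let n ≥ 1 and C₁ > 0. There exists a constant C > 0 depending only on n and C₁ such that the following holds. Let x₀, ξ ∈ ℝⁿ, τ < t₀ be real numbers, and set ρ = (1/4)(|x₀ − ξ|² + (t₀ − τ))^{1/2}. If Γ : ℝⁿ × ℝ → ℝ is a measurable function satisfying 0 ≤ Γ(x, t) ≤ C₁ (t − τ)^{−n/2} exp(−|x − ξ|²/(C₁(t − τ))) for all t > τ and Γ(x, t) = 0 for t ≤ τ, then ∫_{t₀−ρ²}^{t₀} ∫_{B_ρ(x₀)} Γ(x, t)² dx dt ≤ C ρⁿ (t₀ − τ)^{−(n−1)} exp(−|x₀ − ξ|²/(C(t₀ − τ))). -/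
open MeasureTheory Real Set

/-- Squaring a Gaussian bound at time `u ≤ s` and distance `r` gives a bound at time `s` and
distance `d`, provided that `r` is comparable to `d` and the time stays away from `0`
when `d` is small. -/
theorem sq_gaussian_le (n : ℕ) {C₁ u s d r : ℝ} (hC₁ : 0 < C₁) (hu : 0 < u) (hus : u ≤ s)
    (hnear : d ^ 2 ≤ 7 * s → s ≤ 2 * u) (hfar : 7 * s < d ^ 2 → d ^ 2 ≤ 4 * r ^ 2) :
    (C₁ * u ^ (-(n : ℝ) / 2) * Real.exp (-r ^ 2 / (C₁ * u))) ^ 2 ≤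
      C₁ ^ 2 * (2 ^ n * Real.exp (7 / (4 * C₁)) + n.factorial * (4 * C₁) ^ n) * (s ^ n)⁻¹ *
        Real.exp (-d ^ 2 / (4 * C₁ * s)) := by
  have hs : 0 < s := hu.trans_le hus
  have hpow : (u ^ (-(n : ℝ) / 2)) ^ 2 = (u ^ n)⁻¹ := by
    rw [← Real.rpow_natCast, ← Real.rpow_mul hu.le, ← Real.rpow_natCast u n,
      ← Real.rpow_neg hu.le]
    congr 1
    push_cast
    ring
  have hexp : Real.exp (-r ^ 2 / (C₁ * u)) ^ 2 = Real.exp (-(2 * r ^ 2 / (C₁ * u))) := by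
    rw [← Real.exp_nat_mul]
    congr 1
    push_cast
    ring
  rw [mul_pow, mul_pow, hpow, hexp, mul_assoc, mul_assoc, mul_assoc]
  refine mul_le_mul_of_nonneg_left ?_ (by positivity)
  rw [add_mul]
  rcases le_or_gt (d ^ 2) (7 * s) with hd | hd
  · have h1 : (u ^ n)⁻¹ ≤ 2 ^ n * (s ^ n)⁻¹ := by
      have h2 : s ^ n ≤ 2 ^ n * u ^ n := by
        rw [← mul_pow]
        exact pow_le_pow_left₀ hs.le (hnear hd) n
      rw [← div_eq_mul_inv, le_div_iff₀ (by positivity), inv_mul_le_iff₀ (by positivity)]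
      linarith
    have h3 : Real.exp (-(2 * r ^ 2 / (C₁ * u))) ≤
        Real.exp (7 / (4 * C₁)) * Real.exp (-d ^ 2 / (4 * C₁ * s)) := by
      rw [← Real.exp_add]
      refine Real.exp_le_exp.2 ?_
      have h4 : 7 / (4 * C₁) + -d ^ 2 / (4 * C₁ * s) = (7 * s - d ^ 2) / (4 * C₁ * s) := by
        field_simp
        ring
      have h5 : 0 ≤ (7 * s - d ^ 2) / (4 * C₁ * s) := div_nonneg (by linarith) (by positivity)
      have h6 : 0 ≤ 2 * r ^ 2 / (C₁ * u) := by positivity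
      linarith
    have h7 := mul_le_mul h1 h3 (Real.exp_pos _).le (by positivity)
    have h8 : 0 ≤ (n.factorial : ℝ) * (4 * C₁) ^ n *
      ((s ^ n)⁻¹ * Real.exp (-d ^ 2 / (4 * C₁ * s))) := by positivity
    linarith
  · have hd0 : 0 < d ^ 2 := by linarith
    set y := d ^ 2 / (4 * C₁ * u) with hy
    have hy0 : 0 < y := by positivity
    have h1 : Real.exp (-(2 * r ^ 2 / (C₁ * u))) ≤ Real.exp (-y) * Real.exp (-y) := by
      rw [← Real.exp_add]
      refine Real.exp_le_exp.2 ?_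
      have h2 : 2 * r ^ 2 / (C₁ * u) - (y + y) = (4 * r ^ 2 - d ^ 2) / (2 * (C₁ * u)) := by
        rw [hy]
        field_simp
        ring
      have h3 : 0 ≤ (4 * r ^ 2 - d ^ 2) / (2 * (C₁ * u)) :=
        div_nonneg (by linarith [hfar hd]) (by positivity)
      linarith
    have h4 : Real.exp (-y) ≤ Real.exp (-d ^ 2 / (4 * C₁ * s)) := by
      refine Real.exp_le_exp.2 ?_
      rw [neg_div, hy]
      gcongr
    have h5 : (u ^ n)⁻¹ * Real.exp (-y) ≤ n.factorial * (4 * C₁) ^ n * (s ^ n)⁻¹ := by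
      have h6 : y ^ n / n.factorial ≤ Real.exp y := Real.pow_div_factorial_le_exp y hy0.le n
      have h7 : (s / (4 * C₁ * u)) ^ n ≤ y ^ n := by
        rw [hy]
        gcongr
        linarith
      rw [div_le_iff₀ (by positivity)] at h6
      rw [div_pow, mul_pow] at h7
      have h8 := (div_le_iff₀ (by positivity)).1 (h7.trans h6)
      rw [Real.exp_neg, ← mul_inv, ← div_eq_mul_inv, le_div_iff₀ (by positivity),
        inv_mul_le_iff₀ (by positivity)]
      linarith
    have h9 : (u ^ n)⁻¹ * Real.exp (-(2 * r ^ 2 / (C₁ * u))) ≤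
        n.factorial * (4 * C₁) ^ n * (s ^ n)⁻¹ * Real.exp (-d ^ 2 / (4 * C₁ * s)) :=
      calc _ ≤ (u ^ n)⁻¹ * (Real.exp (-y) * Real.exp (-y)) := by gcongr
        _ = (u ^ n)⁻¹ * Real.exp (-y) * Real.exp (-y) := by ring
        _ ≤ _ := mul_le_mul h5 h4 (Real.exp_pos _).le (by positivity)
    have h10 : 0 ≤ 2 ^ n * Real.exp (7 / (4 * C₁)) *
      ((s ^ n)⁻¹ * Real.exp (-d ^ 2 / (4 * C₁ * s))) := by positivity
    linarith

/-- A function vanishing for `t ≤ τ` and bounded by `M` on the rest of `(a, b)` has integral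
at most `M * (b - τ)` over `(a, b)`. -/
theorem setIntegral_Ioo_le_of_eq_zero {f : ℝ → ℝ} {a b τ M : ℝ} (hτ : τ < b) (hM : 0 ≤ M)
    (hzero : ∀ t ≤ τ, f t = 0) (hbound : ∀ t ∈ Ioo a b, τ < t → |f t| ≤ M) :
    ∫ t in Ioo a b, f t ≤ M * (b - τ) := by
  have hsub : Ioo (max a τ) b ⊆ Ioo τ b := Ioo_subset_Ioo_left (le_max_right _ _)
  have hvol : volume.real (Ioo (max a τ) b) ≤ b - τ := by
    have h := measureReal_mono hsub (μ := volume) (by simp)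
    rwa [Real.volume_real_Ioo_of_le hτ.le] at h
  have heq : ∫ t in Ioo a b, f t = ∫ t in Ioo (max a τ) b, f t := by
    refine setIntegral_eq_of_subset_of_forall_sdiff_eq_zero measurableSet_Ioo
      (Ioo_subset_Ioo_left (le_max_left _ _)) fun t ht => hzero t ?_
    by_contra! h
    exact ht.2 ⟨max_lt ht.1.1 h, ht.1.2⟩
  rw [heq]
  refine (le_abs_self _).trans ?_
  have h := norm_setIntegral_le_of_norm_le_const (μ := volume) (s := Ioo (max a τ) b) (f := f)
    (C := M) (by simp) fun t ht =>
      hbound t ⟨(le_max_left _ _).trans_lt ht.1, ht.2⟩ (hsub ht).1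
  exact h.trans (mul_le_mul_of_nonneg_left hvol hM)


/-- L² bound over a parabolic cylinder for a function satisfying the Aronson
Gaussian upper bound, with `ρ = (1/4)(|x₀−ξ|² + (t₀−τ))^{1/2}`. -/
theorem fundamental_solution_L2_cylinder_bound (n : ℕ) (hn : 1 ≤ n)
    (C₁ : ℝ) (hC₁ : 0 < C₁) :
    ∃ C > 0, ∀ (x₀ ξ : EuclideanSpace ℝ (Fin n)) (τ t₀ : ℝ), τ < t₀ →
      ∀ ρ : ℝ, ρ = (1 / 4) * (‖x₀ - ξ‖ ^ 2 + (t₀ - τ)) ^ (1 / 2 : ℝ) →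
      ∀ Γ : EuclideanSpace ℝ (Fin n) → ℝ → ℝ,
        Measurable (Function.uncurry Γ) →
        (∀ x t, τ < t → 0 ≤ Γ x t ∧
          Γ x t ≤ C₁ * (t - τ) ^ (-(n : ℝ) / 2) *
            Real.exp (-‖x - ξ‖ ^ 2 / (C₁ * (t - τ)))) →
        (∀ x t, t ≤ τ → Γ x t = 0) →
        (∫ t in Ioo (t₀ - ρ ^ 2) t₀, ∫ x in Metric.ball x₀ ρ, (Γ x t) ^ 2) ≤
          C * ρ ^ (n : ℝ) * (t₀ - τ) ^ (-((n : ℝ) - 1)) *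
            Real.exp (-‖x₀ - ξ‖ ^ 2 / (C * (t₀ - τ))) := by
  set A : ℝ := C₁ ^ 2 * (2 ^ n * Real.exp (7 / (4 * C₁)) + n.factorial * (4 * C₁) ^ n) with hA
  have hA0 : 0 < A := by positivity
  set V : ℝ := volume.real (Metric.ball (0 : EuclideanSpace ℝ (Fin n)) 1) with hV
  have hV0 : 0 ≤ V := measureReal_nonneg
  refine ⟨A * V + 4 * C₁, by positivity, ?_⟩
  intro x₀ ξ τ t₀ hτ ρ hρ Γ _ hΓ hΓ0
  set s := t₀ - τ with hs
  have hs0 : 0 < s := sub_pos.2 hτ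
  set d := ‖x₀ - ξ‖ with hd
  have hd0 : 0 ≤ d := norm_nonneg _
  rw [← Real.sqrt_eq_rpow] at hρ
  have hρ0 : 0 < ρ := by
    rw [hρ]
    positivity
  have hρ2 : ρ ^ 2 = (d ^ 2 + s) / 16 := by
    rw [hρ, mul_pow, Real.sq_sqrt (by positivity)]
    ring
  set E : ℝ := Real.exp (-d ^ 2 / (4 * C₁ * s)) with hE
  have hball : volume.real (Metric.ball x₀ ρ) = ρ ^ n * V := by
    rw [measureReal_def, Measure.addHaar_ball_of_pos volume x₀ hρ0, hV, measureReal_def,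
      ENNReal.toReal_mul, ENNReal.toReal_ofReal (by positivity), finrank_euclideanSpace_fin]
  have hpoint : ∀ t ∈ Ioo (t₀ - ρ ^ 2) t₀, τ < t → ∀ x ∈ Metric.ball x₀ ρ,
      ‖Γ x t ^ 2‖ ≤ A * (s ^ n)⁻¹ * E := by
    intro t ht hτt x hx
    rw [Real.norm_of_nonneg (sq_nonneg _)]
    obtain ⟨h0, h1⟩ := hΓ x t hτt
    refine (pow_le_pow_left₀ h0 h1 2).trans ?_
    refine sq_gaussian_le n hC₁ (sub_pos.2 hτt) (by linarith [ht.2]) (fun h => ?_) fun h => ?_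
    · linarith [ht.1]
    · have hρd : ρ ≤ d / 2 := abs_le_of_sq_le_sq' (by nlinarith) (by positivity) |>.2
      have htri : d ≤ ‖x - ξ‖ + ρ := by
        have h2 := dist_triangle x₀ x ξ
        rw [dist_eq_norm x₀ ξ, dist_eq_norm x ξ, dist_comm] at h2
        linarith [Metric.mem_ball.1 hx]
      nlinarith
  have hint : ∫ t in Ioo (t₀ - ρ ^ 2) t₀, ∫ x in Metric.ball x₀ ρ, Γ x t ^ 2 ≤
      A * (s ^ n)⁻¹ * E * (ρ ^ n * V) * s := by
    refine setIntegral_Ioo_le_of_eq_zero hτ (by positivity) (fun t ht => ?_) fun t ht hτt => ?_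
    · simp [hΓ0 _ t ht]
    · rw [← hball]
      exact norm_setIntegral_le_of_norm_le_const measure_ball_lt_top (hpoint t ht hτt)
  refine hint.trans ?_
  have hspow : s ^ (-((n : ℝ) - 1)) = (s ^ n)⁻¹ * s := by
    rw [neg_sub, sub_eq_neg_add, Real.rpow_add hs0, Real.rpow_neg hs0.le, Real.rpow_natCast,
      Real.rpow_one]
  have hEle : E ≤ Real.exp (-d ^ 2 / ((A * V + 4 * C₁) * s)) := by
    refine Real.exp_le_exp.2 ?_
    rw [neg_div, neg_div, neg_le_neg_iff]
    gcongr
    exact le_add_of_nonneg_left (by positivity)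
  rw [hspow, Real.rpow_natCast]
  calc A * (s ^ n)⁻¹ * E * (ρ ^ n * V) * s = A * V * ρ ^ n * ((s ^ n)⁻¹ * s) * E := by ring
    _ ≤ _ := by
      gcongr
      linarith
end

section
/- Let n ≥ 1 and C₂ > 0. There exists a constant C > 0 depending only on n and C₂ such that for every ρ > 0 and every T with 0 < T ≤ ρ², one has ∫₀^T s^{−n} exp(−ρ²/(C₂ s)) ds ≤ C T^{−(n−1)} exp(−ρ²/(C T)). -/
open MeasureTheory Real Set

lemma Real.exp_neg_le_factorial_div_pow {x : ℝ} (hx : 0 < x) (n : ℕ) :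
    Real.exp (-x) ≤ n.factorial / x ^ n := by
  have h := Real.pow_div_factorial_le_exp x hx.le n
  rw [Real.exp_neg, ← inv_div]
  exact inv_anti₀ (by positivity) h

lemma inv_pow_mul_exp_neg_div_le (n : ℕ) {c r s T C : ℝ} (hc : 0 < c) (hs : 0 < s)
    (hsT : s ≤ T) (hTr : T ≤ r) (hC : 2 * c ≤ C) :
    (s ^ n)⁻¹ * Real.exp (-r / (c * s)) ≤
      n.factorial * (2 * c) ^ n * (T ^ n)⁻¹ * Real.exp (-r / (C * T)) := by
  have hT : 0 < T := hs.trans_le hsT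
  have hr : 0 < r := hT.trans_le hTr
  have hC0 : 0 ≤ C := by linarith
  have hsplit : Real.exp (-r / (c * s)) =
      Real.exp (-(r / (2 * c * s))) * Real.exp (-(r / (2 * c * s))) := by
    rw [← Real.exp_add]
    congr 1
    field_simp
    ring
  have hdecay : Real.exp (-(r / (2 * c * s))) ≤ Real.exp (-r / (C * T)) := by
    rw [neg_div]
    gcongr
  have hpoly : (s ^ n)⁻¹ * Real.exp (-(r / (2 * c * s))) ≤
      n.factorial * (2 * c) ^ n * (T ^ n)⁻¹ := by
    calc (s ^ n)⁻¹ * Real.exp (-(r / (2 * c * s)))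
        ≤ (s ^ n)⁻¹ * (n.factorial / (r / (2 * c * s)) ^ n) := by
          gcongr
          exact Real.exp_neg_le_factorial_div_pow (by positivity) n
      _ = n.factorial * (2 * c) ^ n * (r ^ n)⁻¹ := by
          rw [div_pow, mul_pow (2 * c) s]
          field_simp
      _ ≤ n.factorial * (2 * c) ^ n * (T ^ n)⁻¹ := by gcongr
  rw [hsplit, ← mul_assoc]
  gcongr

/-- Bound for `∫₀^T s^{-n} e^{-ρ²/(C₂ s)} ds` when `0 < T ≤ ρ²`. -/
theorem integral_singular_gaussian_bound (n : ℕ) (hn : 1 ≤ n)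
    (C₂ : ℝ) (hC₂ : 0 < C₂) :
    ∃ C > 0, ∀ ρ : ℝ, 0 < ρ → ∀ T : ℝ, 0 < T → T ≤ ρ ^ 2 →
      (∫ s in Ioo (0 : ℝ) T, s ^ (-(n : ℝ)) * Real.exp (-ρ ^ 2 / (C₂ * s))) ≤
        C * T ^ (-((n : ℝ) - 1)) * Real.exp (-ρ ^ 2 / (C * T)) := by
  set K : ℝ := n.factorial * (2 * C₂) ^ n
  have hK : 0 < K := by positivity
  refine ⟨K + 2 * C₂, by positivity, fun ρ _ T hT hTρ => ?_⟩
  set E := Real.exp (-ρ ^ 2 / ((K + 2 * C₂) * T))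
  have hbound : ∀ s ∈ Ioo (0 : ℝ) T,
      ‖s ^ (-(n : ℝ)) * Real.exp (-ρ ^ 2 / (C₂ * s))‖ ≤ K * (T ^ n)⁻¹ * E := by
    rintro s ⟨hs, hsT⟩
    rw [Real.norm_of_nonneg (by positivity), Real.rpow_neg hs.le, Real.rpow_natCast]
    exact inv_pow_mul_exp_neg_div_le n hC₂ hs hsT.le hTρ (by linarith)
  have hpow : T ^ (-((n : ℝ) - 1)) = (T ^ n)⁻¹ * T := by
    rw [neg_sub, sub_eq_neg_add, Real.rpow_add hT, Real.rpow_neg hT.le, Real.rpow_natCast,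
      Real.rpow_one]
  calc (∫ s in Ioo (0 : ℝ) T, s ^ (-(n : ℝ)) * Real.exp (-ρ ^ 2 / (C₂ * s)))
      ≤ K * (T ^ n)⁻¹ * E * volume.real (Ioo (0 : ℝ) T) :=
        (Real.le_norm_self _).trans
          (norm_setIntegral_le_of_norm_le_const measure_Ioo_lt_top hbound)
    _ = K * ((T ^ n)⁻¹ * T) * E := by
        rw [Real.volume_real_Ioo_of_le hT.le]
        ring
    _ ≤ (K + 2 * C₂) * T ^ (-((n : ℝ) - 1)) * E := by
        rw [hpow]
        gcongr
        linarith
end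

section
/- Let n ≥ 2 and let γ = (γ_{ij}) be a real symmetric positive definite n × n matrix. For ξ' = (ξ₁, …, ξ_{n−1}) ∈ ℂ^{n−1} and η ∈ ℂ define p₀ = −γ_{nn}, p₁(ξ') = −2 ∑_{j=1}^{n−1} γ_{nj} ξ_j and p₂(ξ') = −∑_{i,j=1}^{n−1} γ_{ij} ξ_i ξ_j. Then there exists μ > 0 such that for every (ξ', η) ∈ ℂ^{n−1} × ℂ satisfying Im η < μ(|Re η| + |Re ξ'|²) − μ^{−1} |Im ξ'|², the complex number p₁(ξ')² − 4 p₀ p₂(ξ') + 4 p₀ i η does not lie in the real interval [0, ∞) (i.e. it is not a nonnegative real number). -/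
open Finset Complex

/-- A continuous function that is homogeneous of degree two and positive away from the origin
dominates a positive multiple of the squared Euclidean norm. -/
theorem exists_pos_mul_sum_sq_le {ι : Type*} [Fintype ι] (f : (ι → ℝ) → ℝ)
    (hf : Continuous f) (hom : ∀ (t : ℝ) x, f (t • x) = t ^ 2 * f x)
    (hpos : ∀ x, x ≠ 0 → 0 < f x) :
    ∃ c > 0, ∀ x, c * ∑ j, x j ^ 2 ≤ f x := by
  have hcomp : IsCompact {x : ι → ℝ | ∑ j, x j ^ 2 = 1} := by
    refine Metric.isCompact_of_isClosed_isBounded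
      (isClosed_eq (by fun_prop) continuous_const) ?_
    refine (Metric.isBounded_closedBall (x := (0 : ι → ℝ)) (r := 1)).subset fun x hx => ?_
    rw [mem_closedBall_zero_iff, pi_norm_le_iff_of_nonneg zero_le_one]
    intro i
    rw [Real.norm_eq_abs, ← sq_le_one_iff_abs_le_one, ← show ∑ j, x j ^ 2 = 1 from hx]
    exact single_le_sum (f := fun j => x j ^ 2) (fun j _ => sq_nonneg _) (mem_univ i)
  obtain ⟨c, hc, hle⟩ := hcomp.exists_forall_le' (a := 0) hf.continuousOn fun x hx => by
    refine hpos x ?_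
    rintro rfl
    simp at hx
  refine ⟨c, hc, fun x => ?_⟩
  have hs : 0 ≤ ∑ j, x j ^ 2 := sum_nonneg fun j _ => sq_nonneg _
  rcases hs.eq_or_lt with h0 | h0
  · have hx : x = 0 := by
      ext j
      have := (sum_eq_zero_iff_of_nonneg (fun j _ => sq_nonneg (x j))).1 h0.symm j (mem_univ j)
      simpa using this
    have h := hom 0 x
    rw [zero_smul] at h
    rw [← h0, hx, h]
    simp
  · set r := √(∑ j, x j ^ 2) with hr
    have hr2 : r ^ 2 = ∑ j, x j ^ 2 := Real.sq_sqrt hs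
    have hr0 : 0 < r := Real.sqrt_pos.2 h0
    have h := hle (r⁻¹ • x) (by
      simp only [Set.mem_ofPred_eq, Pi.smul_apply, smul_eq_mul, mul_pow, ← mul_sum, ← hr2]
      field_simp)
    rw [hom, inv_pow, inv_mul_eq_div, le_div_iff₀ (by positivity), hr2] at h
    exact h

theorem abs_mul_le_sum_sq {ι : Type*} [Fintype ι] (y : ι → ℝ) (i j : ι) :
    |y i * y j| ≤ ∑ k, y k ^ 2 := by
  have hi := single_le_sum (f := fun k => y k ^ 2) (fun k _ => sq_nonneg _) (mem_univ i)
  have hj := single_le_sum (f := fun k => y k ^ 2) (fun k _ => sq_nonneg _) (mem_univ j)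
  rw [abs_le]
  constructor <;> nlinarith [sq_nonneg (y i + y j), sq_nonneg (y i - y j)]

/-- A quadratic form is bounded by a positive multiple of the squared Euclidean norm. -/
theorem Matrix.exists_sum_mul_mul_le {ι : Type*} [Fintype ι] (A : Matrix ι ι ℝ) :
    ∃ C > 0, ∀ y : ι → ℝ, ∑ i, ∑ j, A i j * y i * y j ≤ C * ∑ k, y k ^ 2 := by
  refine ⟨∑ i, ∑ j, |A i j| + 1, by positivity, fun y => ?_⟩
  calc ∑ i, ∑ j, A i j * y i * y j
      ≤ ∑ i, ∑ j, |A i j| * ∑ k, y k ^ 2 := by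
        refine sum_le_sum fun i _ => sum_le_sum fun j _ => ?_
        calc A i j * y i * y j ≤ |A i j * (y i * y j)| := by
              rw [mul_assoc]; exact le_abs_self _
          _ ≤ _ := by
              rw [abs_mul]
              gcongr
              exact abs_mul_le_sum_sq y i j
    _ = (∑ i, ∑ j, |A i j|) * ∑ k, y k ^ 2 := by simp only [sum_mul]
    _ ≤ _ := by
        gcongr
        linarith

/-- The Schur complement of the last diagonal entry, multiplied by that entry. -/
def schurForm {n : ℕ} (γ : Matrix (Fin (n + 1)) (Fin (n + 1)) ℝ) (x y : Fin n → ℝ) : ℝ :=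
  γ (Fin.last n) (Fin.last n) * ∑ i, ∑ j, γ i.castSucc j.castSucc * x i * y j
    - (∑ j, γ (Fin.last n) j.castSucc * x j) * ∑ j, γ (Fin.last n) j.castSucc * y j

section schurForm

variable {n : ℕ} {γ : Matrix (Fin (n + 1)) (Fin (n + 1)) ℝ}

theorem schurForm_comm (hsym : γ.IsSymm) (x y : Fin n → ℝ) :
    schurForm γ x y = schurForm γ y x := by
  have h : ∑ i, ∑ j, γ i.castSucc j.castSucc * x i * y j
      = ∑ i, ∑ j, γ i.castSucc j.castSucc * y i * x j := by
    rw [sum_comm]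
    refine sum_congr rfl fun i _ => sum_congr rfl fun j _ => ?_
    rw [hsym.apply]
    ring
  rw [schurForm, schurForm, h, mul_comm (∑ j, γ (Fin.last n) j.castSucc * x j)]

theorem schurForm_smul_self (t : ℝ) (x : Fin n → ℝ) :
    schurForm γ (t • x) (t • x) = t ^ 2 * schurForm γ x x := by
  have h1 : ∑ i, ∑ j, γ i.castSucc j.castSucc * (t • x) i * (t • x) j
      = t ^ 2 * ∑ i, ∑ j, γ i.castSucc j.castSucc * x i * x j := by
    simp only [mul_sum, Pi.smul_apply, smul_eq_mul]
    refine sum_congr rfl fun i _ => sum_congr rfl fun j _ => by ring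
  have h2 : ∑ j, γ (Fin.last n) j.castSucc * (t • x) j
      = t * ∑ j, γ (Fin.last n) j.castSucc * x j := by
    simp only [mul_sum, Pi.smul_apply, smul_eq_mul]
    refine sum_congr rfl fun j _ => by ring
  rw [schurForm, schurForm, h1, h2]
  ring

theorem schurForm_add_left (x y z : Fin n → ℝ) :
    schurForm γ (x + y) z = schurForm γ x z + schurForm γ y z := by
  simp only [schurForm, Pi.add_apply, mul_add, add_mul, sum_add_distrib]
  ring

theorem schurForm_neg_left (x y : Fin n → ℝ) :
    schurForm γ (-x) y = -schurForm γ x y := by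
  simp only [schurForm, Pi.neg_apply, mul_neg, neg_mul, sum_neg_distrib]
  ring

theorem schurForm_self_pos (hsym : γ.IsSymm) (hpos : γ.PosDef) {x : Fin n → ℝ} (hx : x ≠ 0) :
    0 < schurForm γ x x := by
  have hg : 0 < γ (Fin.last n) (Fin.last n) := hpos.diag_pos
  set g := γ (Fin.last n) (Fin.last n) with hgdef
  set b := ∑ j, γ (Fin.last n) j.castSucc * x j with hb
  have hv : (Fin.snoc (g • x) (-b) : Fin (n + 1) → ℝ) ≠ 0 := by
    intro h
    apply hx
    ext j
    have := congrFun h j.castSucc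
    simpa [hg.ne'] using this
  have h := hpos.dotProduct_mulVec_pos hv
  have e : star (Fin.snoc (g • x) (-b) : Fin (n + 1) → ℝ) ⬝ᵥ
      (γ.mulVec (Fin.snoc (g • x) (-b) : Fin (n + 1) → ℝ)) = g * schurForm γ x x := by
    have h1 : ∑ i : Fin n, g * x i * ∑ j : Fin n, γ i.castSucc j.castSucc * (g * x j)
        = g ^ 2 * ∑ i, ∑ j, γ i.castSucc j.castSucc * x i * x j := by
      simp only [mul_sum]
      refine sum_congr rfl fun i _ => sum_congr rfl fun j _ => by ring
    have h2 : ∑ j : Fin n, γ (Fin.last n) j.castSucc * (g * x j) = g * b := by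
      rw [hb, mul_sum]
      refine sum_congr rfl fun j _ => by ring
    have h3 : ∑ i : Fin n, g * x i * (γ i.castSucc (Fin.last n) * -b) = -(g * b * b) := by
      conv_rhs => rw [← h2, sum_mul, ← sum_neg_distrib]
      refine sum_congr rfl fun j _ => ?_
      rw [hsym.apply]
      ring
    simp only [dotProduct, Matrix.mulVec, Fin.sum_univ_castSucc, Pi.star_apply, star_trivial,
      Fin.snoc_castSucc, Fin.snoc_last, Pi.smul_apply, smul_eq_mul, mul_add, sum_add_distrib,
      h1, h2, h3]
    rw [schurForm, ← hgdef, ← hb]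
    ring
  rw [e] at h
  exact pos_of_mul_pos_right h hg.le

theorem schurForm_self_nonneg (hsym : γ.IsSymm) (hpos : γ.PosDef) (x : Fin n → ℝ) :
    0 ≤ schurForm γ x x := by
  rcases eq_or_ne x 0 with rfl | hx
  · simp [schurForm]
  · exact (schurForm_self_pos hsym hpos hx).le

theorem two_mul_abs_schurForm_le (hsym : γ.IsSymm) (hpos : γ.PosDef) (x y : Fin n → ℝ) :
    2 * |schurForm γ x y| ≤ schurForm γ x x + schurForm γ y y := by
  have hadd := schurForm_self_nonneg hsym hpos (x + y)
  have hsub := schurForm_self_nonneg hsym hpos (-x + y)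
  rw [schurForm_add_left, schurForm_comm hsym x (x + y), schurForm_comm hsym y (x + y),
    schurForm_add_left, schurForm_add_left, schurForm_comm hsym y x] at hadd
  rw [schurForm_add_left, schurForm_comm hsym (-x) (-x + y), schurForm_comm hsym y (-x + y),
    schurForm_add_left, schurForm_add_left, schurForm_neg_left, schurForm_neg_left,
    schurForm_comm hsym x (-x), schurForm_comm hsym y (-x), schurForm_neg_left,
    schurForm_neg_left] at hsub
  have : |schurForm γ x y| ≤ (schurForm γ x x + schurForm γ y y) / 2 :=
    abs_le.2 ⟨by linarith, by linarith⟩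
  linarith

theorem exists_schurForm_self_le (hpos : γ.PosDef) :
    ∃ C > 0, ∀ y : Fin n → ℝ, schurForm γ y y ≤ C * ∑ k, y k ^ 2 := by
  have hg : 0 < γ (Fin.last n) (Fin.last n) := hpos.diag_pos
  obtain ⟨C, hC, h⟩ := (γ.submatrix Fin.castSucc Fin.castSucc).exists_sum_mul_mul_le
  refine ⟨γ (Fin.last n) (Fin.last n) * C, by positivity, fun y => ?_⟩
  have := mul_le_mul_of_nonneg_left (h y) hg.le
  simp only [Matrix.submatrix_apply] at this
  rw [schurForm]
  nlinarith [mul_self_nonneg (∑ j, γ (Fin.last n) j.castSucc * y j)]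

theorem discriminant_eq (hsym : γ.IsSymm) (ξ : Fin n → ℂ) (η : ℂ) :
    (-2 * ∑ j, (γ (Fin.last n) j.castSucc : ℂ) * ξ j) ^ 2
          - 4 * (-(γ (Fin.last n) (Fin.last n) : ℂ)) *
            (-∑ i, ∑ j, (γ i.castSucc j.castSucc : ℂ) * ξ i * ξ j)
          + 4 * (-(γ (Fin.last n) (Fin.last n) : ℂ)) * Complex.I * η
      = -4 * (((schurForm γ (fun j => (ξ j).re) fun j => (ξ j).re)
            - (schurForm γ (fun j => (ξ j).im) fun j => (ξ j).im)
            - γ (Fin.last n) (Fin.last n) * η.im : ℝ)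
          + (2 * (schurForm γ (fun j => (ξ j).re) fun j => (ξ j).im)
            + γ (Fin.last n) (Fin.last n) * η.re : ℝ) * Complex.I) := by
  set x : Fin n → ℝ := fun j => (ξ j).re with hx
  set y : Fin n → ℝ := fun j => (ξ j).im with hy
  have hξ : ∀ j, ξ j = x j + y j * Complex.I := fun j => (Complex.re_add_im (ξ j)).symm
  have hb : ∑ j, (γ (Fin.last n) j.castSucc : ℂ) * ξ j
      = (∑ j, γ (Fin.last n) j.castSucc * x j : ℝ)
        + (∑ j, γ (Fin.last n) j.castSucc * y j : ℝ) * Complex.I := by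
    push_cast
    rw [sum_mul, ← sum_add_distrib]
    refine sum_congr rfl fun j _ => ?_
    rw [hξ]
    ring
  have hcomm : ∑ i, ∑ j, γ i.castSucc j.castSucc * y i * x j
      = ∑ i, ∑ j, γ i.castSucc j.castSucc * x i * y j := by
    rw [sum_comm]
    refine sum_congr rfl fun i _ => sum_congr rfl fun j _ => ?_
    rw [hsym.apply]
    ring
  have hQ : ∑ i, ∑ j, (γ i.castSucc j.castSucc : ℂ) * ξ i * ξ j
      = (∑ i, ∑ j, γ i.castSucc j.castSucc * x i * x j : ℝ)
        - (∑ i, ∑ j, γ i.castSucc j.castSucc * y i * y j : ℝ)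
        + ((∑ i, ∑ j, γ i.castSucc j.castSucc * x i * y j : ℝ)
          + (∑ i, ∑ j, γ i.castSucc j.castSucc * y i * x j : ℝ)) * Complex.I := by
    push_cast
    simp only [sum_mul, add_mul, ← sum_add_distrib, ← sum_sub_distrib]
    refine sum_congr rfl fun i _ => sum_congr rfl fun j _ => ?_
    rw [hξ i, hξ j]
    linear_combination (γ i.castSucc j.castSucc : ℂ) * y i * y j * Complex.I_sq
  rw [hcomm] at hQ
  rw [hb, hQ]
  conv_lhs => rw [← Complex.re_add_im η]
  simp only [schurForm]
  generalize ∑ i, ∑ j, γ i.castSucc j.castSucc * x i * x j = a₁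
  generalize ∑ i, ∑ j, γ i.castSucc j.castSucc * y i * y j = a₂
  generalize ∑ i, ∑ j, γ i.castSucc j.castSucc * x i * y j = a₃
  generalize ∑ j, γ (Fin.last n) j.castSucc * x j = b₁
  generalize ∑ j, γ (Fin.last n) j.castSucc * y j = b₂
  push_cast
  linear_combination (4 * (b₂ : ℂ) ^ 2
    - 4 * (γ (Fin.last n) (Fin.last n) : ℂ) * η.im) * Complex.I_sq

end schurForm

/-- For a symmetric positive definite `(n+1)×(n+1)` matrix `γ` (total dimension
at least 2), there is `μ > 0` such that for `(ξ', η)` in the region `L_μ`,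
`p₁(ξ')² − 4p₀p₂(ξ') + 4p₀iη` is never a nonnegative real number. -/
theorem discriminant_avoids_halfline (n : ℕ) (hn : 1 ≤ n)
    (γ : Matrix (Fin (n + 1)) (Fin (n + 1)) ℝ)
    (hsym : γ.IsSymm) (hpos : γ.PosDef) :
    ∃ μ > 0, ∀ (ξ : Fin n → ℂ) (η : ℂ),
      η.im < μ * (|η.re| + ∑ j, ((ξ j).re) ^ 2) - μ⁻¹ * ∑ j, ((ξ j).im) ^ 2 →
      ¬ ∃ m : ℝ, 0 ≤ m ∧
        (-2 * ∑ j, (γ (Fin.last n) j.castSucc : ℂ) * ξ j) ^ 2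
          - 4 * (-(γ (Fin.last n) (Fin.last n) : ℂ)) *
            (-∑ i, ∑ j, (γ i.castSucc j.castSucc : ℂ) * ξ i * ξ j)
          + 4 * (-(γ (Fin.last n) (Fin.last n) : ℂ)) * Complex.I * η = (m : ℂ) := by
  have hg : 0 < γ (Fin.last n) (Fin.last n) := hpos.diag_pos
  obtain ⟨c, hc, hlow⟩ := exists_pos_mul_sum_sq_le (fun x => schurForm γ x x)
    (by unfold schurForm; fun_prop) schurForm_smul_self
    fun x hx => schurForm_self_pos hsym hpos hx
  obtain ⟨C, hC, hup⟩ := exists_schurForm_self_le hpos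
  set g := γ (Fin.last n) (Fin.last n) with hgdef
  obtain ⟨μ, hμ, hμ1, hμ2, hμ3⟩ : ∃ μ > 0, μ ≤ 1 / 2 ∧ μ ≤ c / (2 * g) ∧ μ ≤ g / (2 * C) :=
    ⟨min (1 / 2) (min (c / (2 * g)) (g / (2 * C))), by positivity, min_le_left _ _,
      (min_le_right _ _).trans (min_le_left _ _), (min_le_right _ _).trans (min_le_right _ _)⟩
  refine ⟨μ, hμ, fun ξ η hη => ?_⟩
  rintro ⟨m, hm, heq⟩
  rw [hgdef, discriminant_eq hsym, ← hgdef] at heq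
  have hre := congrArg Complex.re heq
  have him := congrArg Complex.im heq
  have hx := hlow fun j => (ξ j).re
  have hy := hup fun j => (ξ j).im
  have hxy := two_mul_abs_schurForm_le hsym hpos (fun j => (ξ j).re) fun j => (ξ j).im
  have hX : 0 ≤ ∑ j, (ξ j).re ^ 2 := sum_nonneg fun j _ => sq_nonneg _
  have hY : 0 ≤ ∑ j, (ξ j).im ^ 2 := sum_nonneg fun j _ => sq_nonneg _
  generalize (schurForm γ (fun j => (ξ j).re) fun j => (ξ j).re) = sx at *
  generalize (schurForm γ (fun j => (ξ j).im) fun j => (ξ j).im) = sy at *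
  generalize (schurForm γ (fun j => (ξ j).re) fun j => (ξ j).im) = sxy at *
  generalize ∑ j, (ξ j).re ^ 2 = X at *
  generalize ∑ j, (ξ j).im ^ 2 = Y at *
  simp at hre him
  have hηre : g * |η.re| ≤ sx + sy := by
    have : g * η.re = -(2 * sxy) := by linarith
    rw [← abs_of_pos hg, ← abs_mul, this, abs_neg, abs_mul, abs_two]
    exact hxy
  have hμc : μ * g ≤ c / 2 := by
    rw [le_div_iff₀ (by positivity)] at hμ2
    linarith
  have hμC : 2 * C ≤ g * μ⁻¹ := by
    rw [le_div_iff₀ (by positivity)] at hμ3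
    rw [← div_eq_mul_inv, le_div_iff₀ hμ]
    linarith
  have h1 := mul_lt_mul_of_pos_left hη hg
  have h2 := mul_le_mul_of_nonneg_left hηre hμ.le
  have h3 := mul_le_mul_of_nonneg_right hμc hX
  have h4 := mul_le_mul_of_nonneg_right hμC hY
  have hsx : 0 ≤ sx := (mul_nonneg hc.le hX).trans hx
  have h5 := mul_le_mul_of_nonneg_right hμ1 hsx
  have h6 := mul_le_mul_of_nonneg_left hy hμ.le
  have h7 := mul_le_mul_of_nonneg_right hμ1 (mul_nonneg hC.le hY)
  have h8 : 0 ≤ C * Y := mul_nonneg hC.le hY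
  linarith
end
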